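/- Let T ⊆ F be a chain. The following are equivalent: (1) T_* ⊆ F, and for every nonempty C ⊆ T one has ⋃C ∈ F with ν(⋃C) = sup{ν(A) : A ∈ C} and ⋂C ∈ F with ν(⋂C) = inf{ν(A) : A ∈ C}; (2) there exists a chain U ⊆ F with T ⊆ U such that {ν(A) : A ∈ U} is dense in [0,1]; (3) for every ε > 0 there exists N_ε ∈ ℕ such that |ν_N(A) − ν(A)| < ε for all A ∈ T and all N > N_ε. Moreover, if any of these holds, then there exists a chain V ⊆ F with T ⊆ V such that V_* ⊆ F, statement (1) holds with T replaced by V_*, {ν(A) : A ∈ V_*} = [0,1], and statement (3) holds with T replaced by V_*. -/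

import Mathlib

/-- The partial average `ν_N(A) = (1/N)·∑_{n=1}^N 1_A(n)`. -/
noncomputable def nuN (A : Set ℕ) (N : ℕ) : ℝ :=
  (∑ n ∈ Finset.Icc 1 N, A.indicator (fun _ => (1 : ℝ)) n) / N

/-- The upper Cesàro limit `ν⁺(A)`. -/
noncomputable def nuPlus (A : Set ℕ) : ℝ :=
  Filter.limsup (fun N => nuN A N) Filter.atTop

/-- The lower Cesàro limit `ν⁻(A)`. -/
noncomputable def nuMinus (A : Set ℕ) : ℝ :=
  Filter.liminf (fun N => nuN A N) Filter.atTop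

/-- `A ∈ F`: the Cesàro limit of `A` exists. -/
def memF (A : Set ℕ) : Prop :=
  ∃ l : ℝ, Filter.Tendsto (fun N => nuN A N) Filter.atTop (nhds l)

/-- The Cesàro limit `ν(A)`; it coincides with `ν⁺(A)` whenever `A ∈ F`. -/
noncomputable def nu (A : Set ℕ) : ℝ := nuPlus A

/-- `A ∈ N`: `A` is a null set. -/
def nullSet (A : Set ℕ) : Prop := memF A ∧ nu A = 0
/-- `T_∪`: closure of `T` under arbitrary unions. -/
def unionClosure (T : Set (Set ℕ)) : Set (Set ℕ) := {B | ∃ C ⊆ T, B = ⋃₀ C}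

/-- `T_∩`: closure of `T` under arbitrary intersections. -/
def interClosure (T : Set (Set ℕ)) : Set (Set ℕ) := {B | ∃ C ⊆ T, B = ⋂₀ C}

/-- `T_* = T_∪ ∪ T_∩`. -/
def starClosure (T : Set (Set ℕ)) : Set (Set ℕ) := unionClosure T ∪ interClosure T

/-- Statement 1 of the theorem, for a chain `T`. -/
def propOne (T : Set (Set ℕ)) : Prop :=
  (∀ A ∈ starClosure T, memF A) ∧
  ∀ C ⊆ T, C.Nonempty →
    (memF (⋃₀ C) ∧ nu (⋃₀ C) = sSup (nu '' C)) ∧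
    (memF (⋂₀ C) ∧ nu (⋂₀ C) = sInf (nu '' C))

/-- Statement 2 of the theorem, for a chain `T`. -/
def propTwo (T : Set (Set ℕ)) : Prop :=
  ∃ U : Set (Set ℕ), IsChain (· ⊆ ·) U ∧ (∀ A ∈ U, memF A) ∧ T ⊆ U ∧
    Set.Icc (0 : ℝ) 1 ⊆ closure (nu '' U)

/-- Statement 3 of the theorem (uniform convergence), for a chain `T`. -/
def propThree (T : Set (Set ℕ)) : Prop :=
  ∀ ε : ℝ, 0 < ε → ∃ N₀ : ℕ, ∀ A ∈ T, ∀ N : ℕ, N₀ < N → |nuN A N - nu A| < ε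

open Filter Topology

/-- The number of elements of `A` in `{1, …, N}`. -/
noncomputable def posCount (A : Set ℕ) (N : ℕ) : ℕ :=
  open Classical in Nat.count (fun k => k + 1 ∈ A) N

lemma posCount_zero (A : Set ℕ) : posCount A 0 = 0 := by simp [posCount]

open Classical in
lemma posCount_le (A : Set ℕ) (N : ℕ) : posCount A N ≤ N := Nat.count_le _

open Classical in
lemma posCount_succ (A : Set ℕ) (N : ℕ) :
    posCount A (N + 1) = posCount A N + if N + 1 ∈ A then 1 else 0 := by
  simp [posCount, Nat.count_succ]

lemma nuN_eq_posCount_div (A : Set ℕ) (N : ℕ) : nuN A N = (posCount A N : ℝ) / N := by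
  classical
  have h : ∑ n ∈ Finset.Icc 1 N, A.indicator (fun _ => (1 : ℝ)) n = posCount A N := by
    induction N with
    | zero => simp [posCount_zero]
    | succ N ih =>
      rw [Finset.sum_Icc_succ_top (by omega), ih, posCount_succ]
      simp [Set.indicator_apply]
  rw [nuN, h]

lemma nuN_mono_of_forall_le {A B : Set ℕ} {N : ℕ} (h : ∀ k ≤ N, k ∈ A → k ∈ B) :
    nuN A N ≤ nuN B N := by
  unfold nuN
  refine div_le_div_of_nonneg_right (Finset.sum_le_sum fun n hn => ?_) (by positivity)
  by_cases hA : n ∈ A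
  · simp [hA, h n (Finset.mem_Icc.1 hn).2 hA]
  · simp only [hA, not_false_eq_true, Set.indicator_of_notMem]
    exact Set.indicator_nonneg (by simp) _

lemma nuN_mono {A B : Set ℕ} (h : A ⊆ B) (N : ℕ) : nuN A N ≤ nuN B N :=
  nuN_mono_of_forall_le fun _ _ hk => h hk

lemma nuN_nonneg (A : Set ℕ) (N : ℕ) : 0 ≤ nuN A N := by
  rw [nuN_eq_posCount_div]; positivity

lemma nuN_le_one (A : Set ℕ) (N : ℕ) : nuN A N ≤ 1 := by
  rw [nuN_eq_posCount_div]
  refine div_le_one_of_le₀ ?_ (by positivity)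
  exact_mod_cast posCount_le A N

lemma nuN_empty (N : ℕ) : nuN ∅ N = 0 := by simp [nuN]

lemma nuN_univ {N : ℕ} (hN : 0 < N) : nuN Set.univ N = 1 := by
  have : (N : ℝ) ≠ 0 := by positivity
  simp [nuN, this]

lemma nu_eq_of_tendsto {A : Set ℕ} {l : ℝ} (h : Tendsto (nuN A) atTop (𝓝 l)) : nu A = l :=
  h.limsup_eq

lemma memF.tendsto_nu {A : Set ℕ} (h : memF A) : Tendsto (nuN A) atTop (𝓝 (nu A)) := by
  obtain ⟨l, hl⟩ := h
  rwa [nu_eq_of_tendsto hl]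

lemma memF.nu_mem_Icc {A : Set ℕ} (h : memF A) : nu A ∈ Set.Icc (0 : ℝ) 1 :=
  ⟨ge_of_tendsto' h.tendsto_nu (nuN_nonneg A), le_of_tendsto' h.tendsto_nu (nuN_le_one A)⟩

lemma memF.nu_mono {A B : Set ℕ} (hA : memF A) (hB : memF B) (h : A ⊆ B) : nu A ≤ nu B :=
  le_of_tendsto_of_tendsto' hA.tendsto_nu hB.tendsto_nu (nuN_mono h)

lemma tendsto_nuN_empty : Tendsto (nuN ∅) atTop (𝓝 0) :=
  tendsto_const_nhds.congr fun N => (nuN_empty N).symm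

lemma tendsto_nuN_univ : Tendsto (nuN Set.univ) atTop (𝓝 1) :=
  tendsto_const_nhds.congr' <| (eventually_gt_atTop 0).mono fun _ hN => (nuN_univ hN).symm

lemma memF.bddAbove {C : Set (Set ℕ)} (hC : ∀ A ∈ C, memF A) : BddAbove (nu '' C) :=
  ⟨1, by rintro _ ⟨A, hA, rfl⟩; exact (hC A hA).nu_mem_Icc.2⟩

lemma memF.bddBelow {C : Set (Set ℕ)} (hC : ∀ A ∈ C, memF A) : BddBelow (nu '' C) :=
  ⟨0, by rintro _ ⟨A, hA, rfl⟩; exact (hC A hA).nu_mem_Icc.1⟩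

section StarClosure

lemma subset_starClosure (T : Set (Set ℕ)) : T ⊆ starClosure T := fun A hA =>
  Or.inl ⟨{A}, by simpa using hA, by simp⟩

lemma starClosure_induction {T : Set (Set ℕ)} {p : Set ℕ → Prop}
    (hempty : p ∅) (huniv : p Set.univ)
    (hunion : ∀ C ⊆ T, C.Nonempty → p (⋃₀ C)) (hinter : ∀ C ⊆ T, C.Nonempty → p (⋂₀ C)) :
    ∀ A ∈ starClosure T, p A := by
  rintro _ (⟨C, hC, rfl⟩ | ⟨C, hC, rfl⟩) <;> rcases C.eq_empty_or_nonempty with rfl | hne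
  · simpa using hempty
  · exact hunion C hC hne
  · simpa using huniv
  · exact hinter C hC hne

lemma comparable_starClosure {T : Set (Set ℕ)} {X : Set ℕ}
    (h : ∀ A ∈ T, X ⊆ A ∨ A ⊆ X) : ∀ B ∈ starClosure T, X ⊆ B ∨ B ⊆ X := by
  rintro _ (⟨C, hC, rfl⟩ | ⟨C, hC, rfl⟩)
  · by_cases hX : ∃ A ∈ C, X ⊆ A
    · obtain ⟨A, hA, hXA⟩ := hX
      exact Or.inl (hXA.trans (Set.subset_sUnion_of_mem hA))
    · push Not at hX
      exact Or.inr (Set.sUnion_subset fun A hA => (h A (hC hA)).resolve_left (hX A hA))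
  · by_cases hX : ∃ A ∈ C, A ⊆ X
    · obtain ⟨A, hA, hXA⟩ := hX
      exact Or.inr ((Set.sInter_subset_of_mem hA).trans hXA)
    · push Not at hX
      exact Or.inl (Set.subset_sInter fun A hA => (h A (hC hA)).resolve_right (hX A hA))

lemma IsChain.starClosure {T : Set (Set ℕ)} (h : IsChain (· ⊆ ·) T) :
    IsChain (· ⊆ ·) (starClosure T) := fun A hA B hB _ =>
  comparable_starClosure (fun _ hC =>
    (comparable_starClosure (fun _ hD => h.total hC hD) A hA).symm) B hB

end StarClosure

section UniformConvergence

lemma IsChain.exists_mem_forall_le_sUnion {C : Set (Set ℕ)} (hC : IsChain (· ⊆ ·) C)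
    (hne : C.Nonempty) (N : ℕ) : ∃ A ∈ C, ∀ k < N, k ∈ ⋃₀ C → k ∈ A := by
  induction N with
  | zero => exact hne.imp fun A hA => ⟨hA, by simp⟩
  | succ N ih =>
    obtain ⟨A, hA, h⟩ := ih
    by_cases hN : N ∈ ⋃₀ C
    · obtain ⟨B, hB, hNB⟩ := hN
      rcases hC.total hA hB with hAB | hBA
      · refine ⟨B, hB, fun k hk hkC => ?_⟩
        rcases Nat.lt_succ_iff_lt_or_eq.1 hk with hk | rfl
        exacts [hAB (h k hk hkC), hNB]
      · refine ⟨A, hA, fun k hk hkC => ?_⟩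
        rcases Nat.lt_succ_iff_lt_or_eq.1 hk with hk | rfl
        exacts [h k hk hkC, hBA hNB]
    · refine ⟨A, hA, fun k hk hkC => ?_⟩
      rcases Nat.lt_succ_iff_lt_or_eq.1 hk with hk | rfl
      exacts [h k hk hkC, absurd hkC hN]

lemma IsChain.exists_mem_forall_le_sInter {C : Set (Set ℕ)} (hC : IsChain (· ⊆ ·) C)
    (hne : C.Nonempty) (N : ℕ) : ∃ A ∈ C, ∀ k < N, k ∈ A → k ∈ ⋂₀ C := by
  induction N with
  | zero => exact hne.imp fun A hA => ⟨hA, by simp⟩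
  | succ N ih =>
    obtain ⟨A, hA, h⟩ := ih
    by_cases hN : N ∈ ⋂₀ C
    · refine ⟨A, hA, fun k hk hkC => ?_⟩
      rcases Nat.lt_succ_iff_lt_or_eq.1 hk with hk | rfl
      exacts [h k hk hkC, hN]
    · obtain ⟨B, hB, hNB⟩ : ∃ B ∈ C, N ∉ B := by simpa using hN
      rcases hC.total hA hB with hAB | hBA
      · refine ⟨A, hA, fun k hk hkC => ?_⟩
        rcases Nat.lt_succ_iff_lt_or_eq.1 hk with hk | rfl
        exacts [h k hk hkC, absurd (hAB hkC) hNB]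
      · refine ⟨B, hB, fun k hk hkC => ?_⟩
        rcases Nat.lt_succ_iff_lt_or_eq.1 hk with hk | rfl
        exacts [h k hk (hBA hkC), absurd hkC hNB]

variable {C : Set (Set ℕ)}

lemma abs_nuN_sUnion_sub_le (hC : IsChain (· ⊆ ·) C) (hne : C.Nonempty)
    (hF : ∀ A ∈ C, memF A) {ε : ℝ} {N : ℕ} (h : ∀ A ∈ C, |nuN A N - nu A| < ε) :
    |nuN (⋃₀ C) N - sSup (nu '' C)| ≤ ε := by
  obtain ⟨A, hA, hAC⟩ := hC.exists_mem_forall_le_sUnion hne (N + 1)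
  have h₁ : nuN (⋃₀ C) N ≤ nuN A N :=
    nuN_mono_of_forall_le fun k hk => hAC k (Nat.lt_succ_of_le hk)
  have h₂ : nu A ≤ sSup (nu '' C) := le_csSup (memF.bddAbove hF) (Set.mem_image_of_mem _ hA)
  have h₃ : sSup (nu '' C) ≤ nuN (⋃₀ C) N + ε := by
    refine csSup_le (hne.image _) ?_
    rintro _ ⟨B, hB, rfl⟩
    have := abs_lt.1 (h B hB)
    have := nuN_mono (Set.subset_sUnion_of_mem hB) N
    linarith
  have := abs_lt.1 (h A hA)
  exact abs_le.2 ⟨by linarith, by linarith⟩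

lemma abs_nuN_sInter_sub_le (hC : IsChain (· ⊆ ·) C) (hne : C.Nonempty)
    (hF : ∀ A ∈ C, memF A) {ε : ℝ} {N : ℕ} (h : ∀ A ∈ C, |nuN A N - nu A| < ε) :
    |nuN (⋂₀ C) N - sInf (nu '' C)| ≤ ε := by
  obtain ⟨A, hA, hAC⟩ := hC.exists_mem_forall_le_sInter hne (N + 1)
  have h₁ : nuN A N ≤ nuN (⋂₀ C) N :=
    nuN_mono_of_forall_le fun k hk => hAC k (Nat.lt_succ_of_le hk)
  have h₂ : sInf (nu '' C) ≤ nu A := csInf_le (memF.bddBelow hF) (Set.mem_image_of_mem _ hA)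
  have h₃ : nuN (⋂₀ C) N - ε ≤ sInf (nu '' C) := by
    refine le_csInf (hne.image _) ?_
    rintro _ ⟨B, hB, rfl⟩
    have := abs_lt.1 (h B hB)
    have := nuN_mono (Set.sInter_subset_of_mem hB) N
    linarith
  have := abs_lt.1 (h A hA)
  exact abs_le.2 ⟨by linarith, by linarith⟩

lemma tendsto_nuN_of_abs_sub_le {A : Set ℕ} {l : ℝ}
    (h : ∀ ε : ℝ, 0 < ε → ∃ N₀ : ℕ, ∀ N, N₀ < N → |nuN A N - l| ≤ ε) :
    Tendsto (nuN A) atTop (𝓝 l) := by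
  refine Metric.tendsto_atTop.2 fun ε hε => ?_
  obtain ⟨N₀, hN₀⟩ := h (ε / 2) (by positivity)
  refine ⟨N₀ + 1, fun N hN => ?_⟩
  rw [Real.dist_eq]
  linarith [hN₀ N (by omega)]

lemma propThree.mono {S T : Set (Set ℕ)} (h : propThree T) (hST : S ⊆ T) : propThree S :=
  fun ε hε => (h ε hε).imp fun _ hN A hA => hN A (hST hA)

lemma propThree.tendsto_sUnion (h : propThree C) (hC : IsChain (· ⊆ ·) C) (hne : C.Nonempty)
    (hF : ∀ A ∈ C, memF A) : Tendsto (nuN (⋃₀ C)) atTop (𝓝 (sSup (nu '' C))) :=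
  tendsto_nuN_of_abs_sub_le fun ε hε => (h ε hε).imp fun _ hN N hlt =>
    abs_nuN_sUnion_sub_le hC hne hF fun A hA => hN A hA N hlt

lemma propThree.tendsto_sInter (h : propThree C) (hC : IsChain (· ⊆ ·) C) (hne : C.Nonempty)
    (hF : ∀ A ∈ C, memF A) : Tendsto (nuN (⋂₀ C)) atTop (𝓝 (sInf (nu '' C))) :=
  tendsto_nuN_of_abs_sub_le fun ε hε => (h ε hε).imp fun _ hN N hlt =>
    abs_nuN_sInter_sub_le hC hne hF fun A hA => hN A hA N hlt

variable {T : Set (Set ℕ)}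

theorem propThree.propOne (h : propThree T) (hchain : IsChain (· ⊆ ·) T)
    (hT : ∀ A ∈ T, memF A) : propOne T := by
  have hU : ∀ C ⊆ T, C.Nonempty → Tendsto (nuN (⋃₀ C)) atTop (𝓝 (sSup (nu '' C))) :=
    fun C hC hne => (h.mono hC).tendsto_sUnion (hchain.mono hC) hne fun A hA => hT A (hC hA)
  have hI : ∀ C ⊆ T, C.Nonempty → Tendsto (nuN (⋂₀ C)) atTop (𝓝 (sInf (nu '' C))) :=
    fun C hC hne => (h.mono hC).tendsto_sInter (hchain.mono hC) hne fun A hA => hT A (hC hA)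
  exact ⟨starClosure_induction ⟨_, tendsto_nuN_empty⟩ ⟨_, tendsto_nuN_univ⟩
      (fun C hC hne => ⟨_, hU C hC hne⟩) (fun C hC hne => ⟨_, hI C hC hne⟩),
    fun C hC hne => ⟨⟨⟨_, hU C hC hne⟩, nu_eq_of_tendsto (hU C hC hne)⟩,
      ⟨_, hI C hC hne⟩, nu_eq_of_tendsto (hI C hC hne)⟩⟩

theorem propThree.starClosure (h : propThree T) (hchain : IsChain (· ⊆ ·) T)
    (hT : ∀ A ∈ T, memF A) : propThree (starClosure T) := by
  intro ε hε
  obtain ⟨N₀, hN₀⟩ := h (ε / 2) (by positivity)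
  refine ⟨N₀, starClosure_induction ?_ ?_ ?_ ?_⟩
  · intro N _
    simpa [nuN_empty, nu_eq_of_tendsto tendsto_nuN_empty]
  · intro N hN
    simpa [nuN_univ (Nat.zero_lt_of_lt hN), nu_eq_of_tendsto tendsto_nuN_univ]
  · intro C hC hne N hN
    have hF : ∀ A ∈ C, memF A := fun A hA => hT A (hC hA)
    rw [nu_eq_of_tendsto ((h.mono hC).tendsto_sUnion (hchain.mono hC) hne hF)]
    linarith [abs_nuN_sUnion_sub_le (hchain.mono hC) hne hF fun A hA => hN₀ A (hC hA) N hN]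
  · intro C hC hne N hN
    have hF : ∀ A ∈ C, memF A := fun A hA => hT A (hC hA)
    rw [nu_eq_of_tendsto ((h.mono hC).tendsto_sInter (hchain.mono hC) hne hF)]
    linarith [abs_nuN_sInter_sub_le (hchain.mono hC) hne hF fun A hA => hN₀ A (hC hA) N hN]

theorem propThree_of_dense (hchain : IsChain (· ⊆ ·) T) (hT : ∀ A ∈ T, memF A)
    (hd : Set.Icc (0 : ℝ) 1 ⊆ closure (nu '' T)) : propThree T := by
  intro ε hε
  obtain ⟨δ, hδ, rfl⟩ : ∃ δ, 0 < δ ∧ ε = 8 * δ := ⟨ε / 8, by positivity, by ring⟩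
  have hex : ∀ x : ℝ, ∃ A, x ∈ Set.Icc (0 : ℝ) 1 → A ∈ T ∧ |x - nu A| < δ := by
    intro x
    by_cases hx : x ∈ Set.Icc (0 : ℝ) 1
    · obtain ⟨_, ⟨A, hA, rfl⟩, hd⟩ := Metric.mem_closure_iff.1 (hd hx) δ hδ
      exact ⟨A, fun _ => ⟨hA, hd⟩⟩
    · exact ⟨∅, fun h => absurd h hx⟩
  choose A hA using hex
  obtain ⟨t, ht, hcov⟩ := isCompact_Icc.elim_nhds_subcover (X := ℝ) (s := Set.Icc 0 1)
    (fun x => Metric.ball x δ) fun x _ => Metric.ball_mem_nhds x hδ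
  have hev : ∀ᶠ N in atTop, ∀ x ∈ t, |nuN (A x) N - nu (A x)| < δ :=
    (Finset.eventually_all t).2 fun x hx =>
      (Metric.tendsto_nhds.1 (hT _ (hA x (ht x hx)).1).tendsto_nu δ hδ)
  obtain ⟨N₀, hN₀⟩ := eventually_atTop.1 hev
  have happrox : ∀ y ∈ Set.Icc (0 : ℝ) 1, ∀ N, N₀ < N → ∃ B ∈ T,
      |y - nu B| < 2 * δ ∧ |nuN B N - nu B| < δ := by
    intro y hy N hN
    obtain ⟨x, hx, hyx⟩ : ∃ x ∈ t, y ∈ Metric.ball x δ := by simpa using hcov hy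
    refine ⟨A x, (hA x (ht x hx)).1, ?_, hN₀ N hN.le x hx⟩
    rw [Metric.mem_ball, Real.dist_eq] at hyx
    linarith [abs_sub_le y x (nu (A x)), (hA x (ht x hx)).2]
  refine ⟨N₀, fun C hC N hN => ?_⟩
  have hc := (hT C hC).nu_mem_Icc
  rw [abs_lt]
  constructor
  · by_cases h : 0 ≤ nu C - 3 * δ
    · obtain ⟨B, hB, h₁, h₂⟩ := happrox (nu C - 3 * δ) ⟨h, by linarith [hc.2]⟩ N hN
      rw [abs_lt] at h₁ h₂
      have hBC : B ⊆ C := (hchain.total hB hC).resolve_right fun hCB => by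
        linarith [(hT C hC).nu_mono (hT B hB) hCB]
      linarith [nuN_mono hBC N]
    · linarith [nuN_nonneg C N]
  · by_cases h : nu C + 3 * δ ≤ 1
    · obtain ⟨B, hB, h₁, h₂⟩ := happrox (nu C + 3 * δ) ⟨by linarith [hc.1], h⟩ N hN
      rw [abs_lt] at h₁ h₂
      have hCB : C ⊆ B := (hchain.total hC hB).resolve_right fun hBC => by
        linarith [(hT B hB).nu_mono (hT C hC) hBC]
      linarith [nuN_mono hCB N]
    · linarith [nuN_le_one C N]

end UniformConvergence

section VanDerCorput

/-- The base-two van der Corput sequence. -/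
noncomputable def vanDerCorput (n : ℕ) : ℝ :=
  if n = 0 then 0 else (vanDerCorput (n / 2) + (n % 2 : ℕ)) / 2
termination_by n

lemma vanDerCorput_eq (n : ℕ) :
    vanDerCorput n = (vanDerCorput (n / 2) + (n % 2 : ℕ)) / 2 := by
  by_cases h : n = 0
  · subst h
    rw [vanDerCorput]
    simp
  · conv_lhs => rw [vanDerCorput, if_neg h]

lemma vanDerCorput_two_mul (n : ℕ) : vanDerCorput (2 * n) = vanDerCorput n / 2 := by
  rw [vanDerCorput_eq]; simp

lemma vanDerCorput_two_mul_add_one (n : ℕ) :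
    vanDerCorput (2 * n + 1) = (vanDerCorput n + 1) / 2 := by
  rw [vanDerCorput_eq, show (2 * n + 1) / 2 = n by omega, show (2 * n + 1) % 2 = 1 by omega]
  simp

lemma vanDerCorput_mem_Ico (n : ℕ) : vanDerCorput n ∈ Set.Ico (0 : ℝ) 1 := by
  induction n using Nat.strong_induction_on with
  | _ n ih =>
    by_cases h : n = 0
    · subst h; simp [vanDerCorput]
    · obtain ⟨h₀, h₁⟩ := ih (n / 2) (by omega)
      rcases Nat.even_or_odd' n with ⟨k, rfl | rfl⟩
      · rw [show 2 * k / 2 = k by omega] at h₀ h₁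
        rw [vanDerCorput_two_mul]
        constructor <;> linarith
      · rw [show (2 * k + 1) / 2 = k by omega] at h₀ h₁
        rw [vanDerCorput_two_mul_add_one]
        constructor <;> linarith

/-- The number of the first `N` terms of the van der Corput sequence below `t`. -/
noncomputable def vanDerCorputCount (t : ℝ) (N : ℕ) : ℕ :=
  open Classical in Nat.count (fun k => vanDerCorput k < t) N

lemma vanDerCorputCount_zero (t : ℝ) : vanDerCorputCount t 0 = 0 := by
  simp [vanDerCorputCount]

open Classical in
lemma vanDerCorputCount_le (t : ℝ) (N : ℕ) : vanDerCorputCount t N ≤ N := Nat.count_le _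

open Classical in
lemma vanDerCorputCount_succ (t : ℝ) (N : ℕ) : vanDerCorputCount t (N + 1) =
    vanDerCorputCount t N + if vanDerCorput N < t then 1 else 0 := by
  simp [vanDerCorputCount, Nat.count_succ]

lemma vanDerCorputCount_of_nonpos {t : ℝ} (ht : t ≤ 0) (N : ℕ) : vanDerCorputCount t N = 0 := by
  induction N with
  | zero => exact vanDerCorputCount_zero t
  | succ N ih =>
    rw [vanDerCorputCount_succ, ih, if_neg (ht.trans (vanDerCorput_mem_Ico N).1).not_gt]

lemma vanDerCorputCount_of_one_le {t : ℝ} (ht : 1 ≤ t) (N : ℕ) : vanDerCorputCount t N = N := by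
  induction N with
  | zero => exact vanDerCorputCount_zero t
  | succ N ih =>
    rw [vanDerCorputCount_succ, ih, if_pos ((vanDerCorput_mem_Ico N).2.trans_le ht)]

lemma vanDerCorputCount_two_mul (t : ℝ) (N : ℕ) : vanDerCorputCount t (2 * N) =
    vanDerCorputCount (2 * t) N + vanDerCorputCount (2 * t - 1) N := by
  induction N with
  | zero => simp [vanDerCorputCount_zero]
  | succ N ih =>
    rw [show 2 * (N + 1) = 2 * N + 1 + 1 by ring]
    simp only [vanDerCorputCount_succ, ih, vanDerCorput_two_mul, vanDerCorput_two_mul_add_one]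
    have h₁ : vanDerCorput N / 2 < t ↔ vanDerCorput N < 2 * t := by
      constructor <;> intro h <;> linarith
    have h₂ : (vanDerCorput N + 1) / 2 < t ↔ vanDerCorput N < 2 * t - 1 := by
      constructor <;> intro h <;> linarith
    simp only [h₁, h₂]
    ring

lemma vanDerCorputCount_two_mul_add_one (t : ℝ) (N : ℕ) : vanDerCorputCount t (2 * N + 1) =
    vanDerCorputCount (2 * t) (N + 1) + vanDerCorputCount (2 * t - 1) N := by
  have h : vanDerCorput N / 2 < t ↔ vanDerCorput N < 2 * t := by
    constructor <;> intro h <;> linarith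
  simp only [vanDerCorputCount_succ, vanDerCorputCount_two_mul, vanDerCorput_two_mul, h]
  ring

lemma abs_vanDerCorputCount_sub_le (m : ℕ) : ∀ t ∈ Set.Icc (0 : ℝ) 1, ∀ N : ℕ,
    |(vanDerCorputCount t N : ℝ) - t * N| ≤ m + N / 2 ^ m := by
  induction m with
  | zero =>
    rintro t ⟨h₀, h₁⟩ N
    have h₂ : (vanDerCorputCount t N : ℝ) ≤ N := by exact_mod_cast vanDerCorputCount_le t N
    have h₃ : (0 : ℝ) ≤ vanDerCorputCount t N := by positivity
    have h₄ : t * N ≤ N := mul_le_of_le_one_left (by positivity) h₁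
    have h₅ : 0 ≤ t * N := by positivity
    rw [abs_le]
    constructor <;> simp <;> linarith
  | succ m ih =>
    rintro t ⟨h₀, h₁⟩ N
    have hpow : (1 : ℝ) / 2 ^ (m + 1) ≤ 1 / 2 := by
      rw [pow_succ]
      have : (1 : ℝ) ≤ 2 ^ m := one_le_pow₀ (by norm_num)
      gcongr
      linarith
    have hhalf : ∀ x : ℝ, x / 2 ^ m = 2 * x / 2 ^ (m + 1) := fun x => by
      rw [pow_succ]; field_simp
    have hpos : (0 : ℝ) < 1 / 2 ^ (m + 1) := by positivity
    rcases le_total (2 * t) 1 with ht | ht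
    · rcases Nat.even_or_odd' N with ⟨k, rfl | rfl⟩
      · rw [vanDerCorputCount_two_mul, vanDerCorputCount_of_nonpos (t := 2 * t - 1) (by linarith)]
        have := abs_le.1 (ih (2 * t) ⟨by linarith, ht⟩ k)
        rw [hhalf] at this
        push_cast
        rw [abs_le]
        constructor <;> linarith
      · rw [vanDerCorputCount_two_mul_add_one,
          vanDerCorputCount_of_nonpos (t := 2 * t - 1) (by linarith)]
        have := abs_le.1 (ih (2 * t) ⟨by linarith, ht⟩ (k + 1))
        rw [hhalf] at this
        push_cast at this ⊢
        rw [show 2 * ((k : ℝ) + 1) / 2 ^ (m + 1) =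
          (2 * k + 1) / 2 ^ (m + 1) + 1 / 2 ^ (m + 1) by ring] at this
        rw [abs_le]
        constructor <;> linarith
    · have hone := vanDerCorputCount_of_one_le ht
      rcases Nat.even_or_odd' N with ⟨k, rfl | rfl⟩
      · rw [vanDerCorputCount_two_mul, hone]
        have := abs_le.1 (ih (2 * t - 1) ⟨by linarith, by linarith⟩ k)
        rw [hhalf] at this
        push_cast
        rw [abs_le]
        constructor <;> linarith
      · rw [vanDerCorputCount_two_mul_add_one, hone]
        have := abs_le.1 (ih (2 * t - 1) ⟨by linarith, by linarith⟩ k)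
        rw [hhalf] at this
        push_cast
        rw [show (2 * (k : ℝ) + 1) / 2 ^ (m + 1) =
          2 * k / 2 ^ (m + 1) + 1 / 2 ^ (m + 1) by ring]
        rw [abs_le]
        constructor <;> linarith

end VanDerCorput

section Interpolation

/-- The elements of `D` whose rank in `D` indexes a van der Corput term below `t`. -/
def thin (D : Set ℕ) (t : ℝ) : Set ℕ := {n | n ∈ D ∧ vanDerCorput (posCount D (n - 1)) < t}

lemma thin_mono (D : Set ℕ) {s t : ℝ} (h : s ≤ t) : thin D s ⊆ thin D t :=
  fun _ hn => ⟨hn.1, hn.2.trans_le h⟩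

lemma posCount_thin (D : Set ℕ) (t : ℝ) (N : ℕ) :
    posCount (thin D t) N = vanDerCorputCount t (posCount D N) := by
  induction N with
  | zero => simp [posCount_zero, vanDerCorputCount_zero]
  | succ N ih =>
    rw [posCount_succ, posCount_succ, ih]
    by_cases h : N + 1 ∈ D
    · simp [thin, h, vanDerCorputCount_succ]
    · simp [thin, h]

lemma tendsto_nuN_thin {D : Set ℕ} {d t : ℝ} (hD : Tendsto (nuN D) atTop (𝓝 d))
    (ht : t ∈ Set.Icc (0 : ℝ) 1) : Tendsto (nuN (thin D t)) atTop (𝓝 (t * d)) := by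
  have hdiff : Tendsto (fun N => nuN (thin D t) N - t * nuN D N) atTop (𝓝 0) := by
    refine Metric.tendsto_nhds.2 fun ε hε => ?_
    obtain ⟨m, hm⟩ := exists_pow_lt_of_lt_one (half_pos hε) (by norm_num : (1 / 2 : ℝ) < 1)
    have hsmall : ∀ᶠ N : ℕ in atTop, (m : ℝ) / N < ε / 2 :=
      (tendsto_const_div_atTop_nhds_zero_nat (m : ℝ)).eventually_lt_const (half_pos hε)
    filter_upwards [hsmall, eventually_gt_atTop 0] with N hN hpos
    have hN' : (0 : ℝ) < N := by exact_mod_cast hpos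
    have hle : (posCount D N : ℝ) ≤ N := by exact_mod_cast posCount_le D N
    rw [Real.dist_eq, sub_zero, nuN_eq_posCount_div, nuN_eq_posCount_div, posCount_thin,
      ← mul_div_assoc, ← sub_div, abs_div, abs_of_pos hN', div_lt_iff₀ hN']
    calc _ ≤ (m : ℝ) + posCount D N / 2 ^ m := abs_vanDerCorputCount_sub_le m t ht _
      _ ≤ m + (1 / 2) ^ m * N := by
        rw [div_pow, one_pow, one_div_mul_eq_div]; gcongr
      _ < ε / 2 * N + ε / 2 * N := by
        rw [div_lt_iff₀ hN'] at hN
        gcongr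
      _ = ε * N := by ring
  simpa using hdiff.add (hD.const_mul t)

lemma nuN_union_of_disjoint {A B : Set ℕ} (h : Disjoint A B) (N : ℕ) :
    nuN (A ∪ B) N = nuN A N + nuN B N := by
  simp [nuN, Set.indicator_union_of_disjoint h, Finset.sum_add_distrib, add_div]

/-- A set between `A` and `B` of density `t`, when `A ⊆ B` and `nu A ≤ t ≤ nu B`. -/
noncomputable def interpolate (A B : Set ℕ) (t : ℝ) : Set ℕ :=
  A ∪ thin (B \ A) ((t - nu A) / (nu B - nu A))

variable {A B : Set ℕ}

lemma subset_interpolate (A B : Set ℕ) (t : ℝ) : A ⊆ interpolate A B t := Set.subset_union_left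

lemma interpolate_subset (h : A ⊆ B) (t : ℝ) : interpolate A B t ⊆ B :=
  Set.union_subset h fun _ hn => hn.1.1

lemma interpolate_mono (h : nu A ≤ nu B) {s t : ℝ} (hst : s ≤ t) :
    interpolate A B s ⊆ interpolate A B t :=
  Set.union_subset_union_right _ <| thin_mono _ <|
    div_le_div_of_nonneg_right (by linarith) (by linarith)

lemma tendsto_nuN_interpolate (hA : memF A) (hB : memF B) (h : A ⊆ B) {t : ℝ}
    (hAt : nu A ≤ t) (htB : t ≤ nu B) : Tendsto (nuN (interpolate A B t)) atTop (𝓝 t) := by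
  have hD : Tendsto (nuN (B \ A)) atTop (𝓝 (nu B - nu A)) := by
    refine (hB.tendsto_nu.sub hA.tendsto_nu).congr fun N => ?_
    have := nuN_union_of_disjoint (Set.disjoint_sdiff_right (s := A) (t := B)) N
    rw [Set.union_sdiff_cancel h] at this
    linarith
  have hs : (t - nu A) / (nu B - nu A) ∈ Set.Icc (0 : ℝ) 1 :=
    ⟨div_nonneg (by linarith) (by linarith), div_le_one_of_le₀ (by linarith) (by linarith)⟩
  have hlim := hA.tendsto_nu.add (tendsto_nuN_thin hD hs)
  have ht : nu A + (t - nu A) / (nu B - nu A) * (nu B - nu A) = t := by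
    rcases eq_or_ne (nu B - nu A) 0 with h0 | h0
    · rw [h0]; linarith
    · rw [div_mul_cancel₀ _ h0]; ring
  rw [ht] at hlim
  exact hlim.congr fun N => (nuN_union_of_disjoint
    (Set.disjoint_sdiff_right.mono_right fun _ hn => hn.1) N).symm

end Interpolation

section Extension

variable {T : Set (Set ℕ)}

/-- The union of the members of `T` of density at most `t`. -/
def lowerHull (T : Set (Set ℕ)) (t : ℝ) : Set ℕ := ⋃₀ {C ∈ T | nu C ≤ t}

/-- The intersection of the members of `T` of density greater than `t`. -/
def upperHull (T : Set (Set ℕ)) (t : ℝ) : Set ℕ := ⋂₀ {C ∈ T | t < nu C}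

lemma lowerHull_subset_upperHull (hchain : IsChain (· ⊆ ·) T) (hT : ∀ A ∈ T, memF A) (t : ℝ) :
    lowerHull T t ⊆ upperHull T t :=
  Set.sUnion_subset fun A hA => Set.subset_sInter fun B hB =>
    (hchain.total hA.1 hB.1).resolve_right fun h => by
      linarith [(hT B hB.1).nu_mono (hT A hA.1) h, hA.2, hB.2]

lemma propOne.lowerHull_spec (h : propOne T) {t : ℝ} (ht : 0 ≤ t) :
    memF (lowerHull T t) ∧ nu (lowerHull T t) ≤ t := by
  refine ⟨h.1 _ (Or.inl ⟨_, Set.sep_subset _ _, rfl⟩), ?_⟩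
  rcases {C ∈ T | nu C ≤ t}.eq_empty_or_nonempty with he | hne
  · rwa [lowerHull, he, Set.sUnion_empty, nu_eq_of_tendsto tendsto_nuN_empty]
  · rw [lowerHull, (h.2 _ (Set.sep_subset _ _) hne).1.2]
    refine csSup_le (hne.image _) ?_
    rintro _ ⟨C, hC, rfl⟩
    exact hC.2

lemma propOne.upperHull_spec (h : propOne T) {t : ℝ} (ht : t ≤ 1) :
    memF (upperHull T t) ∧ t ≤ nu (upperHull T t) := by
  refine ⟨h.1 _ (Or.inr ⟨_, Set.sep_subset _ _, rfl⟩), ?_⟩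
  rcases {C ∈ T | t < nu C}.eq_empty_or_nonempty with he | hne
  · rwa [upperHull, he, Set.sInter_empty, nu_eq_of_tendsto tendsto_nuN_univ]
  · rw [upperHull, (h.2 _ (Set.sep_subset _ _) hne).2.2]
    refine le_csInf (hne.image _) ?_
    rintro _ ⟨C, hC, rfl⟩
    exact hC.2.le

theorem propOne.exists_chain_extension (h : propOne T) (hchain : IsChain (· ⊆ ·) T)
    (hT : ∀ A ∈ T, memF A) : ∃ V : Set (Set ℕ), IsChain (· ⊆ ·) V ∧ (∀ A ∈ V, memF A) ∧
      T ⊆ V ∧ Set.Icc (0 : ℝ) 1 ⊆ nu '' V := by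
  let M : ℝ → Set ℕ := fun t => interpolate (lowerHull T t) (upperHull T t) t
  have hlim : ∀ t ∈ Set.Icc (0 : ℝ) 1, Tendsto (nuN (M t)) atTop (𝓝 t) := fun t ht =>
    tendsto_nuN_interpolate (h.lowerHull_spec ht.1).1 (h.upperHull_spec ht.2).1
      (lowerHull_subset_upperHull hchain hT t) (h.lowerHull_spec ht.1).2 (h.upperHull_spec ht.2).2
  have hle : ∀ t, ∀ C ∈ T, nu C ≤ t → C ⊆ M t := fun t C hC hCt =>
    (Set.subset_sUnion_of_mem (show C ∈ {C ∈ T | nu C ≤ t} from ⟨hC, hCt⟩)).trans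
      (subset_interpolate _ _ t)
  have hlt : ∀ t, ∀ C ∈ T, t < nu C → M t ⊆ C := fun t C hC hCt =>
    (interpolate_subset (lowerHull_subset_upperHull hchain hT t) t).trans
      (Set.sInter_subset_of_mem (show C ∈ {C ∈ T | t < nu C} from ⟨hC, hCt⟩))
  have hTM : ∀ t, ∀ C ∈ T, C ⊆ M t ∨ M t ⊆ C := fun t C hC =>
    (le_or_gt (nu C) t).imp (hle t C hC) (hlt t C hC)
  have hmono : ∀ s ∈ Set.Icc (0 : ℝ) 1, ∀ t, s ≤ t → M s ⊆ M t := by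
    intro s hs t hst
    by_cases hex : ∃ C ∈ T, s < nu C ∧ nu C ≤ t
    · obtain ⟨C, hC, hsC, hCt⟩ := hex
      exact (hlt s C hC hsC).trans (hle t C hC hCt)
    · push Not at hex
      have hL : lowerHull T t = lowerHull T s := by
        refine congrArg Set.sUnion (Set.ext fun C => and_congr_right fun hC => ?_)
        exact ⟨fun h => not_lt.1 fun h' => (hex C hC h').not_ge h, fun h => h.trans hst⟩
      have hU : upperHull T t = upperHull T s := by
        refine congrArg Set.sInter (Set.ext fun C => and_congr_right fun hC => ?_)
        exact ⟨fun h => hst.trans_lt h, hex C hC⟩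
      simp only [M, hL, hU]
      exact interpolate_mono ((h.lowerHull_spec hs.1).2.trans (h.upperHull_spec hs.2).2) hst
  refine ⟨T ∪ M '' Set.Icc 0 1, ?_, ?_, Set.subset_union_left, fun t ht =>
    ⟨M t, Or.inr ⟨t, ht, rfl⟩, nu_eq_of_tendsto (hlim t ht)⟩⟩
  · rintro A (hA | ⟨s, hs, rfl⟩) B (hB | ⟨t, ht, rfl⟩) -
    · exact hchain.total hA hB
    · exact hTM t A hA
    · exact (hTM s B hB).symm
    · exact (le_total s t).imp (hmono s hs t) (hmono t ht s)
  · rintro A (hA | ⟨t, ht, rfl⟩)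
    exacts [hT A hA, ⟨t, hlim t ht⟩]

end Extension

theorem stmt6 (T : Set (Set ℕ)) (hchain : IsChain (· ⊆ ·) T) (hT : ∀ A ∈ T, memF A) :
    ((propOne T ↔ propTwo T) ∧ (propTwo T ↔ propThree T)) ∧
    (propOne T →
      ∃ V : Set (Set ℕ), IsChain (· ⊆ ·) V ∧ (∀ A ∈ V, memF A) ∧ T ⊆ V ∧
        (∀ A ∈ starClosure V, memF A) ∧
        propOne (starClosure V) ∧
        nu '' starClosure V = Set.Icc (0 : ℝ) 1 ∧
        propThree (starClosure V)) := by
  have h₁₂ : propOne T → propTwo T := fun h => by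
    obtain ⟨V, hV, hVF, hTV, hd⟩ := h.exists_chain_extension hchain hT
    exact ⟨V, hV, hVF, hTV, hd.trans subset_closure⟩
  have h₂₃ : propTwo T → propThree T := fun ⟨U, hU, hUF, hTU, hd⟩ =>
    (propThree_of_dense hU hUF hd).mono hTU
  have h₃₁ : propThree T → propOne T := fun h => h.propOne hchain hT
  refine ⟨⟨⟨h₁₂, h₃₁ ∘ h₂₃⟩, ⟨h₂₃, h₁₂ ∘ h₃₁⟩⟩, fun h => ?_⟩
  obtain ⟨V, hV, hVF, hTV, hd⟩ := h.exists_chain_extension hchain hT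
  have hV₃ := propThree_of_dense hV hVF (hd.trans subset_closure)
  have hVF' : ∀ A ∈ starClosure V, memF A := (hV₃.propOne hV hVF).1
  have hV₃' := hV₃.starClosure hV hVF
  refine ⟨V, hV, hVF, hTV, hVF', hV₃'.propOne hV.starClosure hVF', ?_, hV₃'⟩
  refine subset_antisymm ?_ (hd.trans (Set.image_mono (subset_starClosure V)))
  rintro _ ⟨A, hA, rfl⟩
  exact (hVF' A hA).nu_mem_Icc
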